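/- arXiv:2512.02226 — 3 statements merged into one kernel-verified Lean document; each statement's English description precedes it below -/
import Mathlib

section
/- Let F be a finite field with q elements and V a finite-dimensional F-vector space. Let W ⊂ V be a subspace of codimension 1, and let T : W → V be a linear map that is semi-idempotent as a partial linear map (i.e., T acts as the identity on ∩_j im(T^j), where T^j is the j-fold partial composition). Let e(T, j) be the number of semi-idempotent linear maps S : V → V extending T (S|_W = T) with stable rank j. Then e(T, srk T) = q^(srk T) · e(T, srk T + 1). -/
open Polynomial

section

variable {F V : Type*} [Field F] [AddCommGroup V] [Module F V]

/-- The image of the `j`-th iterate of a partial linear map `T : W → V`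
(domain `W ⊆ V`): `im T⁰ = V` and `im T^{j+1} = T (im T^j ∩ W)`. -/
def iterImage (W : Submodule F V) (T : W →ₗ[F] V) : ℕ → Submodule F V
  | 0 => ⊤
  | j + 1 => Submodule.map T (Submodule.comap W.subtype (iterImage W T j))

/-- A total endomorphism is semi-idempotent iff its minimal polynomial divides
`x^ℓ (x - 1)` for some `ℓ`. -/
def IsSemiIdempotent (S : Module.End F V) : Prop :=
  ∃ ℓ : ℕ, minpoly F S ∣ X ^ ℓ * (X - 1)

/-- The stable rank of a total endomorphism: the dimension of the intersection
of the images of its iterates. -/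
noncomputable def srkEnd (S : Module.End F V) : ℕ :=
  Module.finrank F ↥(⨅ j : ℕ, LinearMap.range (S ^ j))

/-- The stable rank of a partial linear map `T : W → V`: the dimension of the
intersection of the images of its partial iterates. -/
noncomputable def srkPartial (W : Submodule F V) (T : W →ₗ[F] V) : ℕ :=
  Module.finrank F ↥(⨅ j : ℕ, iterImage W T j)

end

namespace SemiIdem

variable {F V : Type*} [Field F] [AddCommGroup V] [Module F V]

/-- Domain of the `j`-th partial iterate. -/
def domI (W : Submodule F V) (E : Module.End F V) (j : ℕ) : Submodule F V where
  carrier := {x | ∀ i < j, (E ^ i) x ∈ W}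
  add_mem' := fun ha hb i hi => by rw [map_add]; exact W.add_mem (ha i hi) (hb i hi)
  zero_mem' := fun i _ => by rw [map_zero]; exact W.zero_mem
  smul_mem' := fun c x hx i hi => by rw [map_smul]; exact W.smul_mem c (hx i hi)

/-- Vectors all of whose iterates stay in `W`. -/
def domInf (W : Submodule F V) (E : Module.End F V) : Submodule F V where
  carrier := {x | ∀ i, (E ^ i) x ∈ W}
  add_mem' := fun ha hb i => by rw [map_add]; exact W.add_mem (ha i) (hb i)
  zero_mem' := fun i => by rw [map_zero]; exact W.zero_mem
  smul_mem' := fun c x hx i => by rw [map_smul]; exact W.smul_mem c (hx i)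

lemma mem_domI {W : Submodule F V} {E : Module.End F V} {j : ℕ} {x : V} :
    x ∈ domI W E j ↔ ∀ i < j, (E ^ i) x ∈ W := Iff.rfl

lemma mem_domInf {W : Submodule F V} {E : Module.End F V} {x : V} :
    x ∈ domInf W E ↔ ∀ i, (E ^ i) x ∈ W := Iff.rfl

lemma domInf_le {W : Submodule F V} {E : Module.End F V} : domInf W E ≤ W := by
  intro x hx
  simpa using hx 0

lemma domInf_inv {W : Submodule F V} {E : Module.End F V} {x : V} (hx : x ∈ domInf W E) :
    E x ∈ domInf W E := by
  intro i
  have := hx (i + 1)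
  rwa [pow_succ] at this

lemma domInf_inv' {W : Submodule F V} {E S : Module.End F V} (h : ∀ x ∈ W, S x = E x)
    {x : V} (hx : x ∈ domInf W E) : S x ∈ domInf W E := by
  rw [h x (domInf_le hx)]; exact domInf_inv hx

lemma pow_inv {S : Module.End F V} {Q : Submodule F V} (h : ∀ x ∈ Q, S x ∈ Q) (n : ℕ)
    {x : V} (hx : x ∈ Q) : (S ^ n) x ∈ Q := by
  induction n with
  | zero => simpa using hx
  | succ n ih => rw [pow_succ']; exact h _ ih

lemma pow_fix {S : Module.End F V} {x : V} (h : S x = x) (n : ℕ) : (S ^ n) x = x := by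
  induction n with
  | zero => simp
  | succ n ih => rw [pow_succ', Module.End.mul_apply, ih, h]

lemma pow_eq {W : Submodule F V} {E S : Module.End F V} (h : ∀ x ∈ W, S x = E x)
    {x : V} {j : ℕ} (hx : x ∈ domI W E j) : ∀ i ≤ j, (S ^ i) x = (E ^ i) x := by
  intro i
  induction i with
  | zero => intro _; simp
  | succ i ih =>
    intro hi
    rw [pow_succ', pow_succ', Module.End.mul_apply, Module.End.mul_apply, ih (by omega)]
    exact h _ (hx i (by omega))

lemma pow_eq' {W : Submodule F V} {E S : Module.End F V} (h : ∀ x ∈ W, S x = E x)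
    {x : V} (hx : x ∈ domInf W E) (i : ℕ) : (S ^ i) x = (E ^ i) x :=
  pow_eq h (j := i) (fun k _ => hx k) i le_rfl

/-- nilpotency bound -/
lemma nil_bound [FiniteDimensional F V] {S : Module.End F V} {Y : Submodule F V}
    (hY : ∀ x ∈ Y, S x ∈ Y) {L d : ℕ} (hL : ∀ x, (S ^ L) x ∈ Y)
    (hd : Module.finrank F V ≤ Module.finrank F Y + d) (x : V) : (S ^ d) x ∈ Y := by
  have hpow : ∀ n : ℕ, ∀ x, ((Y.mapQ Y S hY) ^ n) (Y.mkQ x) = Y.mkQ ((S ^ n) x) := by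
    intro n
    induction n with
    | zero => intro x; simp
    | succ n ih => intro x; rw [pow_succ, pow_succ, Module.End.mul_apply, Module.End.mul_apply, ← ih]; rfl
  have hnil : IsNilpotent (Y.mapQ Y S hY) := by
    refine ⟨L, ?_⟩
    ext x
    have := hpow L x
    simp only [LinearMap.comp_apply]
    rw [this]
    simpa using hL x
  have h1 := Submodule.finrank_quotient_add_finrank Y
  have h2 : (Y.mapQ Y S hY) ^ d = 0 := by
    have h3 : (Y.mapQ Y S hY) ^ (Module.finrank F (V ⧸ Y)) = 0 :=
      by
      have := LinearMap.aeval_self_charpoly (Y.mapQ Y S hY)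
      rw [(LinearMap.isNilpotent_iff_charpoly _).1 hnil] at this
      simpa using this
    exact pow_eq_zero_of_le (by omega) h3
  have := hpow d x
  rw [h2] at this
  simpa using this.symm

/-- `V` is generated by `domInf` and the chain of `v`. -/
lemma span_top {W : Submodule F V} {E S : Module.End F V} (h : ∀ x ∈ W, S x = E x)
    {φ : V →ₗ[F] F} (hφ : ∀ x, x ∈ W ↔ φ x = 0) {m : ℕ} {v : V} (hv : v ∈ domI W E m)
    (hvm : φ ((E ^ m) v) = 1) (hU : domI W E (m + 1) ≤ domInf W E)
    {Q : Submodule F V} (hQ : ∀ x ∈ Q, S x ∈ Q) (hUQ : domInf W E ≤ Q) (hvQ : v ∈ Q) (x : V) :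
    x ∈ Q := by
  have key : ∀ k ≤ m + 1, domI W E (m + 1 - k) ≤ Q := by
    intro k
    induction k with
    | zero => intro _; exact hU.trans hUQ
    | succ k ih =>
      intro hk x hx
      have ih := ih (by omega)
      set j := m + 1 - (k + 1) with hj
      have hjk : m + 1 - k = j + 1 := by omega
      have hkm : j + k = m := by omega
      rw [hjk] at ih
      set c := φ ((E ^ j) x) with hc
      have hSk : (S ^ k) v = (E ^ k) v := pow_eq h hv k (by omega)
      have h1 : x - c • (E ^ k) v ∈ domI W E (j + 1) := by
        intro i hi
        rw [map_sub, map_smul, ← Module.End.mul_apply, ← pow_add]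
        rcases Nat.lt_succ_iff_lt_or_eq.1 hi with hi | rfl
        · exact W.sub_mem (hx i hi) (W.smul_mem _ (hv _ (by omega)))
        · rw [hφ, map_sub, map_smul, hkm, hvm, ← hc]; simp
      have h2 := ih h1
      have h3 : (E ^ k) v ∈ Q := by rw [← hSk]; exact pow_inv hQ k hvQ
      have := Q.add_mem h2 (Q.smul_mem c h3)
      simpa using this
  refine key (m + 1) le_rfl ?_
  intro i hi
  omega

/-- existence of chain -/
lemma exists_chain [FiniteDimensional F V] {W : Submodule F V} {E : Module.End F V}
    {φ : V →ₗ[F] F} (hφ : ∀ x, x ∈ W ↔ φ x = 0) (hW : W ≠ ⊤) :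
    ∃ m : ℕ, ∃ v : V, v ∈ domI W E m ∧ φ ((E ^ m) v) = 1 ∧ domI W E (m + 1) ≤ domInf W E ∧
      Module.finrank F V ≤ Module.finrank F (domInf W E) + (m + 1) := by
  classical
  have hanti : ∀ i j, i ≤ j → domI W E j ≤ domI W E i := fun i j hij x hx k hk => hx k (by omega)
  have hex : ∃ j, domI W E j ≤ domInf W E := by
    let f : ℕ →o (Submodule F V)ᵒᵈ := ⟨fun j => OrderDual.toDual (domI W E j), fun i j hij => hanti i j hij⟩
    obtain ⟨n, hn⟩ := WellFoundedGT.monotone_chain_condition f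
    refine ⟨n, fun x hx i => ?_⟩
    have h1 : domI W E n = domI W E (max n (i + 1)) := hn _ (le_max_left _ _)
    rw [h1] at hx
    exact hx i (by omega)
  have hstep : ∀ j, Module.finrank F (domI W E j) ≤ Module.finrank F (domI W E (j + 1)) + 1 := by
    intro j
    let g : domI W E j →ₗ[F] F := (φ ∘ₗ (E ^ j)) ∘ₗ (domI W E j).subtype
    have h1 := LinearMap.finrank_range_add_finrank_ker g
    have h2 : Module.finrank F (LinearMap.range g) ≤ 1 := by
      simpa using Submodule.finrank_le (LinearMap.range g)
    have h3 : Module.finrank F (LinearMap.ker g) ≤ Module.finrank F (domI W E (j + 1)) := by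
      rw [← Submodule.finrank_map_subtype_eq (domI W E j) (LinearMap.ker g)]
      apply Submodule.finrank_mono
      rintro x ⟨y, hy, rfl⟩
      intro i hi
      rcases Nat.lt_succ_iff_lt_or_eq.1 hi with hi | rfl
      · exact y.2 i hi
      · exact (hφ _).2 hy
    omega
  have hsum : ∀ j, Module.finrank F V ≤ Module.finrank F (domI W E j) + j := by
    intro j
    induction j with
    | zero =>
      have : domI W E 0 = ⊤ := by
        rw [eq_top_iff]; intro x _ i hi; omega
      rw [this, finrank_top]; simp
    | succ j ih => have := hstep j; omega
  have hpos : Nat.find hex ≠ 0 := by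
    intro h0
    have := Nat.find_spec hex
    rw [h0] at this
    apply hW
    rw [eq_top_iff]
    intro x _
    exact domInf_le (this (fun i hi => by omega))
  obtain ⟨m, hm⟩ := Nat.exists_eq_succ_of_ne_zero hpos
  have hspec := Nat.find_spec hex
  rw [hm] at hspec
  have hnot : ¬ domI W E m ≤ domInf W E := Nat.find_min hex (by omega)
  obtain ⟨x, hx, hxU⟩ := SetLike.not_le_iff_exists.1 hnot
  have hxm : φ ((E ^ m) x) ≠ 0 := by
    intro h0
    apply hxU
    apply hspec
    intro i hi
    rcases Nat.lt_succ_iff_lt_or_eq.1 hi with hi | rfl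
    · exact hx i hi
    · exact (hφ _).2 h0
  refine ⟨m, (φ ((E ^ m) x))⁻¹ • x, Submodule.smul_mem _ _ hx, ?_, hspec, ?_⟩
  · rw [map_smul, map_smul, smul_eq_mul, inv_mul_cancel₀ hxm]
  · exact (hsum (m + 1)).trans (Nat.add_le_add_right (Submodule.finrank_mono hspec) _)

lemma semi_iff (S : Module.End F V) :
    IsSemiIdempotent S ↔ ∃ L : ℕ, ∀ x, (S ^ L) (S x) = (S ^ L) x := by
  have : ∀ L : ℕ, aeval S (X ^ L * (X - 1) : F[X]) = S ^ L * (S - 1) := by intro L; simp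
  constructor
  · rintro ⟨L, hL⟩
    refine ⟨L, fun x => ?_⟩
    obtain ⟨p, hp⟩ := hL
    have h1 := this L
    rw [hp, map_mul, minpoly.aeval, zero_mul] at h1
    have h2 := congrArg (fun f : Module.End F V => f x) h1
    simp only [LinearMap.zero_apply, Module.End.mul_apply, LinearMap.sub_apply, map_sub, Module.End.one_apply] at h2
    exact (sub_eq_zero.1 h2.symm)
  · rintro ⟨L, hL⟩
    refine ⟨L, minpoly.dvd F S ?_⟩
    rw [this]
    ext x
    simp [hL x]

/-- fixed space -/
def fixS (S : Module.End F V) : Submodule F V := LinearMap.ker (S - 1)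

lemma mem_fixS {S : Module.End F V} {x : V} : x ∈ fixS S ↔ S x = x := by
  simp [fixS, sub_eq_zero]

lemma pow_mem_fix {S : Module.End F V} {L : ℕ} (hL : ∀ x, (S ^ L) (S x) = (S ^ L) x) (x : V) :
    (S ^ L) x ∈ fixS S := by
  rw [mem_fixS, ← Module.End.mul_apply, ← pow_succ', pow_succ, Module.End.mul_apply, hL]

lemma srk_eq {S : Module.End F V} (h : IsSemiIdempotent S) :
    srkEnd S = Module.finrank F (fixS S) := by
  obtain ⟨L, hL⟩ := (semi_iff S).1 h
  have : (⨅ j : ℕ, LinearMap.range (S ^ j)) = fixS S := by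
    apply le_antisymm
    · intro x hx
      obtain ⟨y, rfl⟩ := (Submodule.mem_iInf _).1 hx L
      exact pow_mem_fix hL y
    · intro x hx
      refine (Submodule.mem_iInf _).2 fun j => ⟨x, pow_fix (mem_fixS.1 hx) j⟩
  rw [srkEnd, this]

lemma fix_inf {W : Submodule F V} {T : W →ₗ[F] V}
    (hT : ∀ x : V, (∀ j : ℕ, x ∈ iterImage W T j) → ∃ hx : x ∈ W, T ⟨x, hx⟩ = x)
    {S : Module.End F V} (hS : ∀ w : W, S w = T w) :
    fixS S ⊓ W = ⨅ j : ℕ, iterImage W T j := by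
  apply le_antisymm
  · rintro x ⟨hx, hxW⟩
    refine (Submodule.mem_iInf _).2 fun j => ?_
    induction j with
    | zero => exact Submodule.mem_top
    | succ j ih =>
      refine ⟨⟨x, hxW⟩, ih, ?_⟩
      rw [← hS]; exact mem_fixS.1 hx
  · intro x hx
    obtain ⟨h1, h2⟩ := hT x ((Submodule.mem_iInf _).1 hx)
    refine ⟨mem_fixS.2 ?_, h1⟩
    rw [← hS] at h2; exact h2

lemma finrank_inf [FiniteDimensional F V] {W R : Submodule F V}
    (hW : Module.finrank F W + 1 = Module.finrank F V) (h : ¬ R ≤ W) :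
    Module.finrank F R = Module.finrank F (R ⊓ W : Submodule F V) + 1 := by
  have h1 := Submodule.finrank_sup_add_finrank_inf_eq R W
  have h2 : W < R ⊔ W := lt_of_le_of_ne le_sup_right fun e => h (by rw [e]; exact le_sup_left)
  have h3 := Submodule.finrank_lt_finrank_of_lt h2
  have h4 := Submodule.finrank_le (R ⊔ W)
  omega

lemma srk_iff0 [FiniteDimensional F V] {W : Submodule F V}
    (hW : Module.finrank F W + 1 = Module.finrank F V) {T : W →ₗ[F] V}
    (hT : ∀ x : V, (∀ j : ℕ, x ∈ iterImage W T j) → ∃ hx : x ∈ W, T ⟨x, hx⟩ = x)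
    {S : Module.End F V} (hS : ∀ w : W, S w = T w) (h : IsSemiIdempotent S) :
    srkEnd S = srkPartial W T ↔ fixS S ≤ W := by
  rw [srk_eq h, srkPartial, ← fix_inf hT hS]
  by_cases hR : fixS S ≤ W
  · rw [inf_eq_left.2 hR]; simp [hR]
  · have := finrank_inf hW hR
    simp only [hR, iff_false]; omega

lemma srk_iff1 [FiniteDimensional F V] {W : Submodule F V}
    (hW : Module.finrank F W + 1 = Module.finrank F V) {T : W →ₗ[F] V}
    (hT : ∀ x : V, (∀ j : ℕ, x ∈ iterImage W T j) → ∃ hx : x ∈ W, T ⟨x, hx⟩ = x)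
    {S : Module.End F V} (hS : ∀ w : W, S w = T w) (h : IsSemiIdempotent S) :
    srkEnd S = srkPartial W T + 1 ↔ ¬ fixS S ≤ W := by
  rw [srk_eq h, srkPartial, ← fix_inf hT hS]
  by_cases hR : fixS S ≤ W
  · rw [inf_eq_left.2 hR]; simp [hR]
  · have := finrank_inf hW hR
    simp only [hR, not_false_eq_true, iff_true]; omega

lemma fix_mem_domInf {W : Submodule F V} {E S : Module.End F V} (h : ∀ x ∈ W, S x = E x)
    {x : V} (hx : S x = x) (hxW : x ∈ W) : x ∈ domInf W E := by
  intro i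
  rw [pow_fix (by rw [← h x hxW, hx])]; exact hxW

lemma pow_iter {W : Submodule F V} {T : W →ₗ[F] V} {E : Module.End F V} (hE : ∀ w : W, E w = T w)
    {x : V} (hx : x ∈ domInf W E) (j : ℕ) : (E ^ j) x ∈ iterImage W T j := by
  induction j with
  | zero => exact Submodule.mem_top
  | succ j ih =>
    refine ⟨⟨(E ^ j) x, hx j⟩, ih, ?_⟩
    rw [← hE, pow_succ']; rfl

lemma exists_stab [FiniteDimensional F V] (W : Submodule F V) (T : W →ₗ[F] V) :
    ∃ l, iterImage W T l ≤ ⨅ j : ℕ, iterImage W T j := by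
  have hs : ∀ n, iterImage W T (n + 1) ≤ iterImage W T n := by
    intro n
    induction n with
    | zero => exact le_top
    | succ n ih => exact Submodule.map_mono (Submodule.comap_mono ih)
  have ha : Antitone (iterImage W T) := antitone_nat_of_succ_le hs
  let f : ℕ →o (Submodule F V)ᵒᵈ := ⟨fun j => OrderDual.toDual (iterImage W T j), fun i j hij => ha hij⟩
  obtain ⟨n, hn⟩ := WellFoundedGT.monotone_chain_condition f
  refine ⟨n, le_iInf fun i => ?_⟩
  have h1 : iterImage W T n = iterImage W T (max n i) := hn _ (le_max_left _ _)
  rw [h1]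
  exact ha (le_max_right _ _)

theorem main_count (F V : Type*) [Field F] [Fintype F]
    [AddCommGroup V] [Module F V] [FiniteDimensional F V]
    (W : Submodule F V) (hW : Module.finrank F W + 1 = Module.finrank F V)
    (T : W →ₗ[F] V)
    (hT : ∀ x : V, (∀ j : ℕ, x ∈ iterImage W T j) → ∃ hx : x ∈ W, T ⟨x, hx⟩ = x) :
    Nat.card {S : Module.End F V // IsSemiIdempotent S ∧ (∀ w : W, S w = T w) ∧
        srkEnd S = srkPartial W T}
      = Fintype.card F ^ srkPartial W T *
        Nat.card {S : Module.End F V // IsSemiIdempotent S ∧ (∀ w : W, S w = T w) ∧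
          srkEnd S = srkPartial W T + 1} := by
  classical
  -- a functional with kernel `W`
  obtain ⟨φ, hφ⟩ : ∃ φ : V →ₗ[F] F, ∀ x, x ∈ W ↔ φ x = 0 := by
    have h1 := Submodule.finrank_quotient_add_finrank W
    have h2 : Module.finrank F (V ⧸ W) = Module.finrank F F := by
      rw [Module.finrank_self]; omega
    let e := LinearEquiv.ofFinrankEq (V ⧸ W) F h2
    exact ⟨e.toLinearMap ∘ₗ W.mkQ, fun x => by simp⟩
  have hWtop : W ≠ ⊤ := by
    rintro rfl
    rw [finrank_top] at hW; omega
  obtain ⟨E, hE0⟩ := LinearMap.exists_extend T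
  have hE : ∀ w : W, E w = T w := fun w => LinearMap.congr_fun hE0 w
  obtain ⟨m, v, hv, hvm, hU, hdim⟩ := exists_chain (E := E) hφ hWtop
  obtain ⟨l, hl⟩ := exists_stab W T
  set U := domInf W E with hUdef
  set I := ⨅ j : ℕ, iterImage W T j with hIdef
  set vm := (E ^ m) v with hvmdef
  have hext : ∀ S : Module.End F V, (∀ w : W, S w = T w) → ∀ x ∈ W, S x = E x := by
    intro S hS x hx
    have h1 := hS ⟨x, hx⟩
    have h2 := hE ⟨x, hx⟩
    exact h1.trans h2.symm
  -- facts on U and I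
  have hIfix : ∀ x ∈ I, x ∈ W ∧ E x = x := by
    intro x hx
    rw [hIdef, ← fix_inf hT hE] at hx
    exact ⟨hx.2, mem_fixS.1 hx.1⟩
  have hIU : I ≤ U := fun x hx => fix_mem_domInf (fun _ _ => rfl) (hIfix x hx).2 (hIfix x hx).1
  have hUl : ∀ x ∈ U, (E ^ l) x ∈ I := fun x hx => hl (pow_iter hE hx l)
  have hSvm : ∀ S : Module.End F V, (∀ w : W, S w = T w) → (S ^ m) v = vm := fun S hS =>
    pow_eq (hext S hS) hv m le_rfl
  have hSUfix : ∀ S : Module.End F V, (∀ w : W, S w = T w) → ∀ x ∈ U, (S ^ l) (S x) = (S ^ l) x := by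
    intro S hS x hx
    rw [← Module.End.mul_apply, ← pow_succ, pow_succ', Module.End.mul_apply,
      pow_eq' (hext S hS) hx l]
    have := hIfix _ (hUl x hx)
    rw [hext S hS _ this.1, this.2]
  -- sufficient condition for semi-idempotence
  have hsemi : ∀ (S : Module.End F V), (∀ w : W, S w = T w) → ∀ n : ℕ, l ≤ n →
      (S ^ n) (S v) = (S ^ n) v → IsSemiIdempotent S := by
    intro S hS n hn hSv
    rw [semi_iff]
    refine ⟨n, fun x => ?_⟩
    have hx : x ∈ LinearMap.ker (S ^ n * (S - 1)) := by
      refine span_top (hext S hS) hφ hv hvm hU (Q := LinearMap.ker (S ^ n * (S - 1))) ?_ ?_ ?_ x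
      · intro y hy
        rw [LinearMap.mem_ker] at hy ⊢
        have hc : Commute (S ^ n * (S - 1)) S :=
          ((Commute.refl S).pow_left n).mul_left ((Commute.refl S).sub_left (Commute.one_left S))
        rw [← Module.End.mul_apply, hc.eq, Module.End.mul_apply, hy, map_zero]
      · intro y hy
        obtain ⟨k, rfl⟩ := Nat.exists_eq_add_of_le' hn
        have h1 := hSUfix S hS y hy
        rw [LinearMap.mem_ker, Module.End.mul_apply, LinearMap.sub_apply, Module.End.one_apply,
          map_sub, pow_add, Module.End.mul_apply, Module.End.mul_apply, h1, sub_self]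
      · rw [LinearMap.mem_ker, Module.End.mul_apply, LinearMap.sub_apply, Module.End.one_apply,
          map_sub, hSv, sub_self]
    rw [LinearMap.mem_ker, Module.End.mul_apply, LinearMap.sub_apply, Module.End.one_apply,
          map_sub] at hx
    exact sub_eq_zero.1 hx
  -- characterization of stable rank k
  have hA : ∀ S : Module.End F V, (∀ w : W, S w = T w) →
      ((IsSemiIdempotent S ∧ srkEnd S = srkPartial W T) ↔ S vm ∈ U) := by
    intro S hS
    constructor
    · rintro ⟨h1, h2⟩
      rw [srk_iff0 hW hT hS h1] at h2
      obtain ⟨L, hL⟩ := (semi_iff S).1 h1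
      have h3 : ∀ x, (S ^ L) x ∈ U := fun x =>
        fix_mem_domInf (hext S hS) (mem_fixS.1 (pow_mem_fix hL x)) (h2 (pow_mem_fix hL x))
      have h4 := nil_bound (fun x hx => domInf_inv' (hext S hS) hx) h3 hdim v
      rw [pow_succ', Module.End.mul_apply, hSvm S hS] at h4
      exact h4
    · intro hz
      have h1 : IsSemiIdempotent S := by
        refine hsemi S hS (l + (m + 1)) (by omega) ?_
        have h5 : (S ^ (m + 1)) v ∈ U := by
          rw [pow_succ', Module.End.mul_apply, hSvm S hS]; exact hz
        have h6 := hSUfix S hS _ h5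
        rw [← Module.End.mul_apply (S ^ (l + (m + 1))), ← pow_succ, pow_succ', pow_add]
        rw [← Module.End.mul_apply (S ^ l) S, ← pow_succ, pow_succ'] at h6
        exact h6
      refine ⟨h1, (srk_iff0 hW hT hS h1).2 ?_⟩
      intro r hr
      have hr' : r ∈ U.comap (S ^ (m + 1)) := by
        refine span_top (hext S hS) hφ hv hvm hU (Q := U.comap (S ^ (m + 1))) ?_ ?_ ?_ r
        · intro y hy
          rw [Submodule.mem_comap] at hy ⊢
          rw [← Module.End.mul_apply, ← pow_succ, pow_succ', Module.End.mul_apply]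
          exact domInf_inv' (hext S hS) hy
        · intro y hy
          exact pow_inv (fun x hx => domInf_inv' (hext S hS) hx) _ hy
        · rw [Submodule.mem_comap, pow_succ', Module.End.mul_apply, hSvm S hS]; exact hz
      rw [Submodule.mem_comap, pow_fix (mem_fixS.1 hr)] at hr'
      exact domInf_le hr'
  -- characterization of stable rank k + 1
  have hB : ∀ S : Module.End F V, (∀ w : W, S w = T w) →
      ((IsSemiIdempotent S ∧ srkEnd S = srkPartial W T + 1) ↔
        S vm - vm ∈ U ⊓ LinearMap.ker (E ^ l)) := by
    intro S hS
    constructor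
    · rintro ⟨h1, h2⟩
      rw [srk_iff1 hW hT hS h1] at h2
      obtain ⟨r, hr, hrW⟩ := SetLike.not_le_iff_exists.1 h2
      have hr1 := mem_fixS.1 hr
      obtain ⟨L, hL⟩ := (semi_iff S).1 h1
      have hφr : φ r ≠ 0 := fun h => hrW ((hφ r).2 h)
      have h3 : ∀ x, (S ^ L) x ∈ U ⊔ Submodule.span F {r} := by
        intro x
        have h4 := mem_fixS.1 (pow_mem_fix hL x)
        set y := (S ^ L) x
        have h5 : y - (φ y / φ r) • r ∈ U := by
          refine fix_mem_domInf (hext S hS) ?_ ?_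
          · rw [map_sub, map_smul, h4, hr1]
          · rw [hφ, map_sub, map_smul, smul_eq_mul, div_mul_cancel₀ _ hφr, sub_self]
        rw [Submodule.mem_sup]
        exact ⟨_, h5, (φ y / φ r) • r, Submodule.smul_mem _ _ (Submodule.mem_span_singleton_self r),
          by abel⟩
      have h4 : Module.finrank F V ≤
          Module.finrank F (U ⊔ Submodule.span F {r} : Submodule F V) + m := by
        have : U < U ⊔ Submodule.span F {r} := by
          refine lt_of_le_of_ne le_sup_left fun e => hrW (domInf_le (E := E) ?_)
          rw [← hUdef, e]
          exact Submodule.mem_sup_right (Submodule.mem_span_singleton_self r)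
        have := Submodule.finrank_lt_finrank_of_lt this
        omega
      have h5 : ∀ x ∈ U ⊔ Submodule.span F {r}, S x ∈ U ⊔ Submodule.span F {r} := by
        intro x hx
        obtain ⟨u, hu, w, hw, rfl⟩ := Submodule.mem_sup.1 hx
        obtain ⟨c, rfl⟩ := Submodule.mem_span_singleton.1 hw
        rw [map_add, map_smul, hr1]
        exact Submodule.add_mem_sup (domInf_inv' (hext S hS) hu) hw
      have h6 := nil_bound h5 h3 h4 v
      rw [hSvm S hS] at h6
      obtain ⟨u, hu, w, hw, hvu⟩ := Submodule.mem_sup.1 h6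
      obtain ⟨c, rfl⟩ := Submodule.mem_span_singleton.1 hw
      have h7 : S vm - vm = S u - u := by
        rw [← hvu, map_add, map_smul, hr1]; abel
      have h8 : S vm - vm ∈ U := by
        rw [h7]; exact U.sub_mem (domInf_inv' (hext S hS) hu) hu
      refine ⟨h8, ?_⟩
      rw [SetLike.mem_coe, LinearMap.mem_ker, ← pow_eq' (hext S hS) h8 l, h7, map_sub, hSUfix S hS u hu, sub_self]
    · rintro ⟨h1, h2⟩
      have h3 : (S ^ l) (S vm) = (S ^ l) vm := by
        rw [SetLike.mem_coe, LinearMap.mem_ker, ← pow_eq' (hext S hS) h1 l, map_sub] at h2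
        exact sub_eq_zero.1 h2
      have h4 : IsSemiIdempotent S := by
        refine hsemi S hS (l + m) (by omega) ?_
        rw [← hSvm S hS, ← Module.End.mul_apply (S ^ l) S, ← pow_succ, pow_succ'] at h3
        rw [← Module.End.mul_apply (S ^ (l + m)), ← pow_succ, pow_succ', pow_add]
        exact h3
      refine ⟨h4, (srk_iff1 hW hT hS h4).2 fun hle => ?_⟩
      have h5 : (S ^ l) vm ∈ fixS S := by
        rw [mem_fixS, ← Module.End.mul_apply, ← pow_succ', pow_succ, Module.End.mul_apply, h3]
      have h6 : ∀ n : ℕ, (S ^ n) vm - vm ∈ U := by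
        intro n
        induction n with
        | zero => simp
        | succ n ih =>
          have : (S ^ (n + 1)) vm - vm = S ((S ^ n) vm - vm) + (S vm - vm) := by
            rw [pow_succ', Module.End.mul_apply, map_sub]; abel
          rw [this]
          exact U.add_mem (domInf_inv' (hext S hS) ih) h1
      have h7 : vm ∈ W := by
        have := W.sub_mem (hle h5) (domInf_le (h6 l))
        simpa using this
      rw [hφ, hvm] at h7
      exact one_ne_zero h7
  -- parametrization of the extensions
  have hex : ∀ z : V, ∃ S : Module.End F V, (∀ w : W, S w = T w) ∧ S vm = z := by
    intro z
    refine ⟨E + φ.smulRight (z - E vm), fun w => ?_, ?_⟩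
    · have : φ w = 0 := (hφ _).1 w.2
      simp [this, hE]
    · simp [hvm]
  have huniq : ∀ S S' : Module.End F V, (∀ w : W, S w = T w) → (∀ w : W, S' w = T w) →
      S vm = S' vm → S = S' := by
    intro S S' hS hS' h
    ext x
    have hx : x - φ x • vm ∈ W := by rw [hφ, map_sub, map_smul, hvm]; simp
    have h1 := (hext S hS _ hx).trans (hext S' hS' _ hx).symm
    rw [map_sub, map_sub, map_smul, map_smul, h] at h1
    exact sub_left_injective h1
  have cA : Nat.card {S : Module.End F V // IsSemiIdempotent S ∧ (∀ w : W, S w = T w) ∧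
        srkEnd S = srkPartial W T} = Nat.card U := by
    refine Nat.card_eq_of_bijective
      (fun S => ⟨S.1 vm, (hA S.1 S.2.2.1).1 ⟨S.2.1, S.2.2.2⟩⟩) ⟨?_, ?_⟩
    · intro S S' h
      exact Subtype.ext (huniq _ _ S.2.2.1 S'.2.2.1 (congrArg Subtype.val h))
    · rintro ⟨z, hz⟩
      obtain ⟨S, hS, rfl⟩ := hex z
      obtain ⟨h1, h2⟩ := (hA S hS).2 hz
      exact ⟨⟨S, h1, hS, h2⟩, rfl⟩
  have cB : Nat.card {S : Module.End F V // IsSemiIdempotent S ∧ (∀ w : W, S w = T w) ∧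
        srkEnd S = srkPartial W T + 1} =
        Nat.card (U ⊓ LinearMap.ker (E ^ l) : Submodule F V) := by
    refine Nat.card_eq_of_bijective
      (fun S => ⟨S.1 vm - vm, (hB S.1 S.2.2.1).1 ⟨S.2.1, S.2.2.2⟩⟩) ⟨?_, ?_⟩
    · intro S S' h
      exact Subtype.ext (huniq _ _ S.2.2.1 S'.2.2.1 (sub_left_injective (congrArg Subtype.val h)))
    · rintro ⟨z, hz⟩
      obtain ⟨S, hS, hSz⟩ := hex (z + vm)
      have hz' : S vm - vm = z := by rw [hSz]; abel
      subst hz'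
      obtain ⟨h1, h2⟩ := (hB S hS).2 hz
      exact ⟨⟨S, h1, hS, h2⟩, rfl⟩
  have hrk : Module.finrank F U = srkPartial W T +
      Module.finrank F (U ⊓ LinearMap.ker (E ^ l) : Submodule F V) := by
    let g : U →ₗ[F] V := (E ^ l) ∘ₗ U.subtype
    have h1 := LinearMap.finrank_range_add_finrank_ker g
    have h2 : LinearMap.range g = I := by
      apply le_antisymm
      · rintro _ ⟨x, rfl⟩
        exact hUl x x.2
      · intro x hx
        exact ⟨⟨x, hIU hx⟩, pow_fix (hIfix x hx).2 l⟩
    have h3 : (LinearMap.ker g).map U.subtype = U ⊓ LinearMap.ker (E ^ l) := by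
      ext x
      constructor
      · rintro ⟨y, hy, rfl⟩
        exact ⟨y.2, hy⟩
      · rintro ⟨hx, hx2⟩
        exact ⟨⟨x, hx⟩, hx2, rfl⟩
    rw [← h3, Submodule.finrank_map_subtype_eq, ← h1, h2, srkPartial]
  rw [cA, cB, Module.natCard_eq_pow_finrank (K := F) (V := U),
    Module.natCard_eq_pow_finrank (K := F) (V := (U ⊓ LinearMap.ker (E ^ l) : Submodule F V)),
    hrk, pow_add, Nat.card_eq_fintype_card]

end SemiIdem

/-- Let `F` be a finite field with `q` elements, `V` a finite-dimensional
`F`-vector space, `W ⊆ V` a subspace of codimension `1`, and `T : W → V` a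
partial linear map that is semi-idempotent (it fixes every vector of the
intersection of the images of its partial iterates).  Writing `e(T, j)` for the
number of semi-idempotent total maps `S : V → V` extending `T` with stable rank
`j`, we have `e(T, srk T) = q^(srk T) · e(T, srk T + 1)`. -/
theorem count_semiIdempotent_extensions (F V : Type*) [Field F] [Fintype F]
    [AddCommGroup V] [Module F V] [FiniteDimensional F V]
    (W : Submodule F V) (hW : Module.finrank F W + 1 = Module.finrank F V)
    (T : W →ₗ[F] V)
    (hT : ∀ x : V, (∀ j : ℕ, x ∈ iterImage W T j) → ∃ hx : x ∈ W, T ⟨x, hx⟩ = x) :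
    Nat.card {S : Module.End F V // IsSemiIdempotent S ∧ (∀ w : W, S w = T w) ∧
        srkEnd S = srkPartial W T}
      = Fintype.card F ^ srkPartial W T *
        Nat.card {S : Module.End F V // IsSemiIdempotent S ∧ (∀ w : W, S w = T w) ∧
          srkEnd S = srkPartial W T + 1} := by
  exact SemiIdem.main_count F V W hW T hT
end

section
/- Let F be a finite field with |F| = q, k a field of characteristic 0, and let M_{n,m} denote the set of n×m matrices over F. Consider the commuting left action of the monoid algebra k[M_n] and right action of k[M_m] on k[M_{n,m}] by left and right matrix multiplication. Then the image of k[M_n] in End_k(k[M_{n,m}]) is exactly the centralizer of the image of k[M_m], and vice versa. -/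
section

variable (F : Type*) [Field F] (n m : ℕ) (k : Type*) [Field k]

/-- The operator on `k[M_{n,m}]` given by left multiplication by `a ∈ M_n`
on basis elements: `[X] ↦ [aX]`. -/
noncomputable def Lop (a : Matrix (Fin n) (Fin n) F) :
    Module.End k (Matrix (Fin n) (Fin m) F →₀ k) :=
  Finsupp.lmapDomain k k fun X => a * X

/-- The operator on `k[M_{n,m}]` given by right multiplication by `b ∈ M_m`
on basis elements: `[X] ↦ [Xb]`. -/
noncomputable def Rop (b : Matrix (Fin m) (Fin m) F) :
    Module.End k (Matrix (Fin n) (Fin m) F →₀ k) :=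
  Finsupp.lmapDomain k k fun X => X * b

end

open Matrix in
/-- factors through `F^r` -/
def Fac {F : Type*} [Field F] {n l : ℕ} (r : ℕ) (X : Matrix (Fin n) (Fin l) F) : Prop :=
  ∃ (A : Matrix (Fin n) (Fin r) F) (B : Matrix (Fin r) (Fin l) F), X = A * B

section aux
variable {F : Type*} [Field F]

lemma Fac.mul_left {n l r a : ℕ} {X : Matrix (Fin n) (Fin l) F} (h : Fac r X)
    (Z : Matrix (Fin a) (Fin n) F) : Fac r (Z * X) := by
  obtain ⟨A, B, rfl⟩ := h
  exact ⟨Z * A, B, by rw [Matrix.mul_assoc]⟩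

lemma Fac.mul_right {n l r a : ℕ} {X : Matrix (Fin n) (Fin l) F} (h : Fac r X)
    (Z : Matrix (Fin l) (Fin a) F) : Fac r (X * Z) := by
  obtain ⟨A, B, rfl⟩ := h
  exact ⟨A, B * Z, by rw [Matrix.mul_assoc]⟩

lemma fac_of_row {m l : ℕ} (M : Matrix (Fin (m+1)) (Fin l) F) (j : Fin (m+1))
    (h : ∀ i, M j i = 0) : Fac m M := by
  refine ⟨(1 : Matrix (Fin (m+1)) (Fin (m+1)) F).submatrix id j.succAbove,
    M.submatrix j.succAbove id, ?_⟩
  have h1 : (1 : Matrix (Fin (m+1)) (Fin (m+1)) F) * M = M := Matrix.one_mul M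
  ext a b
  have h2 := congrFun (congrFun h1 a) b
  rw [Matrix.mul_apply, Fin.sum_univ_succAbove _ j, h b, mul_zero, zero_add] at h2
  rw [← h2, Matrix.mul_apply]
  rfl

lemma Fac.succ {n l r : ℕ} {X : Matrix (Fin n) (Fin l) F} (h : Fac r X) : Fac (r+1) X := by
  obtain ⟨A, B, rfl⟩ := h
  refine ⟨A * (1 : Matrix (Fin (r+1)) (Fin (r+1)) F).submatrix (Fin.succAbove 0) id,
    (1 : Matrix (Fin (r+1)) (Fin (r+1)) F).submatrix id (Fin.succAbove 0) * B, ?_⟩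
  rw [Matrix.mul_assoc, ← Matrix.mul_assoc (Matrix.submatrix _ _ _)]
  have : (1 : Matrix (Fin (r+1)) (Fin (r+1)) F).submatrix (Fin.succAbove 0) id *
    (1 : Matrix (Fin (r+1)) (Fin (r+1)) F).submatrix id (Fin.succAbove 0) = 1 := by
    rw [← Matrix.submatrix_mul _ _ _ _ _ Function.bijective_id, Matrix.one_mul]
    exact Matrix.submatrix_one _ Fin.succAbove_right_injective
  rw [this, Matrix.one_mul]

lemma fac_of_mulVec {n m : ℕ} (X : Matrix (Fin n) (Fin (m+1)) F) (v : Fin (m+1) → F)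
    (hv : v ≠ 0) (h : X.mulVec v = 0) : Fac m X := by
  obtain ⟨j, hj⟩ := Function.ne_iff.mp hv
  have hX : X = X * (1 - Matrix.vecMulVec v (Pi.single j (v j)⁻¹)) := by
    rw [Matrix.mul_sub, Matrix.mul_one, Matrix.mul_vecMulVec, h, Matrix.zero_vecMulVec, sub_zero]
  rw [hX]
  apply Fac.mul_left
  apply fac_of_row _ j
  intro i
  simp only [Pi.zero_apply] at hj
  rw [Matrix.sub_apply, Matrix.vecMulVec_apply, Matrix.one_apply, Pi.single_apply]
  by_cases hi : j = i
  · subst hi; simp [hj]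
  · simp [hi, Ne.symm hi]

lemma fac_or_inv {n m : ℕ} (X : Matrix (Fin n) (Fin (m+1)) F) :
    Fac m X ∨ ∃ p : Matrix (Fin (m+1)) (Fin n) F, p * X = 1 := by
  by_cases h : ∃ v, v ≠ 0 ∧ X.mulVec v = 0
  · obtain ⟨v, hv, h⟩ := h
    exact Or.inl (fac_of_mulVec X v hv h)
  · right
    push Not at h
    have hk : LinearMap.ker (Matrix.toLin' X) = ⊥ := by
      rw [LinearMap.ker_eq_bot']
      intro v hv
      by_contra hne
      exact h v hne (by simpa using hv)
    obtain ⟨g, hg⟩ := LinearMap.exists_leftInverse_of_injective _ hk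
    refine ⟨LinearMap.toMatrix' g, ?_⟩
    have := congrArg LinearMap.toMatrix' hg
    rwa [LinearMap.toMatrix'_comp, LinearMap.toMatrix'_toLin', LinearMap.toMatrix'_id] at this

lemma not_fac_of_inv {n m : ℕ} (X : Matrix (Fin n) (Fin (m+1)) F)
    (p : Matrix (Fin (m+1)) (Fin n) F) (h : p * X = 1) : ¬ Fac m X := by
  intro hf
  obtain ⟨A, B, hAB⟩ := hf.mul_left p
  rw [h] at hAB
  have h1 := Matrix.rank_one (R := F) (n := Fin (m+1))
  rw [hAB] at h1
  have h2 := Matrix.rank_mul_le_left A B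
  have h3 := Matrix.rank_le_width A
  simp at h1
  omega

/-- Property of the coefficient function `g` -/
lemma sum_line [Fintype F] {k : Type*} [Field k] {m : ℕ}
    (g : Matrix (Fin (m+1)) (Fin (m+1)) F → k)
    (hg : ∀ N : Matrix (Fin (m+1)) (Fin (m+1)) F, Fac m N →
      ∀ f : Matrix (Fin (m+1)) (Fin (m+1)) F → k, ∑ e, g e * f (e * N) = 0)
    (d : Fin (m+1) → F) (hd : d ≠ 0) (B : Matrix (Fin (m+1)) (Fin (m+1)) F) :
    ∑ t : Fin (m+1) → F, g (B + Matrix.vecMulVec t d) = 0 := by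
  classical
  obtain ⟨j, hj⟩ := Function.ne_iff.mp hd
  simp only [Pi.zero_apply] at hj
  set v : Fin (m+1) → F := Pi.single j (d j)⁻¹ with hv
  have hdv : d ⬝ᵥ v = 1 := by simp [hv, hj]
  have hv0 : v ≠ 0 := by
    intro h; rw [h] at hdv; simp at hdv
  set N : Matrix (Fin (m+1)) (Fin (m+1)) F := 1 - Matrix.vecMulVec v d with hN
  have hNv : N.mulVec v = 0 := by
    rw [hN, Matrix.sub_mulVec, Matrix.one_mulVec, Matrix.vecMulVec_mulVec, hdv]
    simp
  have hdN : ∀ t : Fin (m+1) → F, Matrix.vecMulVec t d * N = 0 := by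
    intro t
    rw [hN, Matrix.mul_sub, Matrix.mul_one, Matrix.vecMulVec_mul_vecMulVec, hdv]
    simp
  have h := hg N (fac_of_mulVec N v hv0 hNv) (fun M => if M = B * N then 1 else 0)
  simp only [mul_ite, mul_one, mul_zero] at h
  rw [← Finset.sum_filter] at h
  rw [← h]
  refine Finset.sum_bij (fun t _ => B + Matrix.vecMulVec t d) ?_ ?_ ?_ ?_
  · intro t _
    simp [Matrix.add_mul, hdN]
  · intro t _ t' _ heq
    have h1 := add_left_cancel heq
    have h2 := congrArg (fun M => Matrix.mulVec M v) h1
    simpa [Matrix.vecMulVec_mulVec, hdv] using h2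
  · intro e he
    simp only [Finset.mem_filter, Finset.mem_univ, true_and] at he
    refine ⟨(e - B).mulVec v, Finset.mem_univ _, ?_⟩
    have h1 : (e - B) * N = 0 := by rw [Matrix.sub_mul, he, sub_self]
    rw [hN, Matrix.mul_sub, Matrix.mul_one, Matrix.mul_vecMulVec, sub_eq_zero] at h1
    rw [← h1]; abel
  · intro t _; rfl

lemma key [Fintype F] {k : Type*} [Field k] [CharZero k] {m : ℕ} (n : ℕ)
    (g : Matrix (Fin (m+1)) (Fin (m+1)) F → k)
    (hg : ∀ N : Matrix (Fin (m+1)) (Fin (m+1)) F, Fac m N →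
      ∀ f : Matrix (Fin (m+1)) (Fin (m+1)) F → k, ∑ e, g e * f (e * N) = 0)
    (hg1 : g 1 = 1) (hg2 : ∀ e, ¬ Fac m e → e ≠ 1 → g e = 0) :
    ∃ K : k, K ≠ 0 ∧ ∀ (G : Matrix (Fin n) (Fin (m+1)) F → k), (∀ X, Fac m X → G X = 0) →
      ∀ X, ∑ Y : Matrix (Fin n) (Fin (m+1)) F, ∑ p : Matrix (Fin (m+1)) (Fin n) F,
        g (p * Y) * G (Y * p * X) = K * G X := by
  classical
  set c1 : k := (Fintype.card (Matrix (Fin (m+1)) (Fin (m+1)) F) : k) with hc1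
  set c2 : k := (Fintype.card (Matrix (Fin (m+1)) (Fin n) F) : k) with hc2
  set c3 : k := ∑ A : Matrix (Fin (m+1)) (Fin (m+1)) F, ∑ h : Matrix (Fin (m+1)) (Fin (m+1)) F, if h * A = 1 then 1 else 0 with hc3
  have h1 : c1 ≠ 0 := by rw [hc1]; exact_mod_cast Fintype.card_ne_zero
  have h2 : c2 ≠ 0 := by rw [hc2]; exact_mod_cast Fintype.card_ne_zero
  have h3 : c3 ≠ 0 := by
    rw [hc3, ← Finset.sum_product', Finset.sum_boole]
    norm_cast
    apply Finset.card_ne_zero_of_mem (a := ((1 : Matrix (Fin (m+1)) (Fin (m+1)) F), (1 : Matrix (Fin (m+1)) (Fin (m+1)) F)))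
    simp
  refine ⟨c1⁻¹ * c2 * c3, by positivity, ?_⟩
  intro G hG X
  rcases fac_or_inv X with hX | ⟨p0, hp0⟩
  · rw [hG X hX, mul_zero]
    refine Finset.sum_eq_zero fun Y _ => Finset.sum_eq_zero fun p _ => ?_
    rw [hG _ (hX.mul_left _), mul_zero]
  -- averaging over left translates
  have havg : ∀ f : Matrix (Fin (m+1)) (Fin (m+1)) F → k, ∑ p : Matrix (Fin (m+1)) (Fin n) F, f (p * X)
      = c1⁻¹ * c2 * ∑ h, f h := by
    intro f
    have e1 : ∑ h : Matrix (Fin (m+1)) (Fin (m+1)) F, ∑ p : Matrix (Fin (m+1)) (Fin n) F, f (p * X)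
        = ∑ h : Matrix (Fin (m+1)) (Fin (m+1)) F, ∑ p : Matrix (Fin (m+1)) (Fin n) F, f (p * X + h) := by
      refine Finset.sum_congr rfl fun h _ => ?_
      rw [← Equiv.sum_comp (Equiv.addRight (h * p0))]
      refine Finset.sum_congr rfl fun p _ => ?_
      rw [Equiv.coe_addRight, Matrix.add_mul, Matrix.mul_assoc, hp0, Matrix.mul_one]
    rw [Finset.sum_comm (s := Finset.univ) (t := Finset.univ)
      (f := fun (h : Matrix (Fin (m+1)) (Fin (m+1)) F) (p : Matrix (Fin (m+1)) (Fin n) F) => f (p * X + h))] at e1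
    have e2 : ∀ p : Matrix (Fin (m+1)) (Fin n) F, ∑ h : Matrix (Fin (m+1)) (Fin (m+1)) F, f (p * X + h) = ∑ h, f h := by
      intro p
      exact Equiv.sum_comp (Equiv.addLeft (p * X)) f
    simp only [e2, Finset.sum_const, Finset.card_univ, nsmul_eq_mul] at e1
    rw [← hc1, ← hc2] at e1
    rw [mul_assoc, ← e1]
    field_simp
  -- vanishing of the inner sum
  have hvan : ∀ Y : Matrix (Fin n) (Fin (m+1)) F, Y ≠ X * (p0 * Y) →
      ∑ p : Matrix (Fin (m+1)) (Fin n) F, g (p * Y) * G (Y * p * X) = 0 := by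
    intro Y hY
    set P : Matrix (Fin n) (Fin n) F := 1 - X * p0 with hP
    have hPX : P * X = 0 := by
      rw [hP, Matrix.sub_mul, Matrix.mul_assoc, hp0]; simp
    have hPY : P * Y ≠ 0 := by
      intro h
      apply hY
      rw [hP, Matrix.sub_mul, Matrix.one_mul, sub_eq_zero, Matrix.mul_assoc] at h
      exact h
    obtain ⟨i, hi⟩ := Function.ne_iff.mp hPY
    have hdY : Matrix.vecMul (P i) Y = (P * Y) i := rfl
    have hdX : Matrix.vecMul (P i) X = 0 := by
      have : Matrix.vecMul (P i) X = (P * X) i := rfl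
      rw [this, hPX]; rfl
    have e1 : ∑ t : Fin (m+1) → F, ∑ p : Matrix (Fin (m+1)) (Fin n) F,
          g (p * Y) * G (Y * p * X)
        = ∑ t : Fin (m+1) → F, ∑ p : Matrix (Fin (m+1)) (Fin n) F,
          g (p * Y + Matrix.vecMulVec t ((P * Y) i)) * G (Y * p * X) := by
      refine Finset.sum_congr rfl fun t _ => ?_
      rw [← Equiv.sum_comp (Equiv.addRight (Matrix.vecMulVec t (P i)))]
      refine Finset.sum_congr rfl fun p _ => ?_
      simp [Matrix.add_mul, Matrix.mul_assoc, Matrix.vecMulVec_mul, hdX, hdY]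
    rw [Finset.sum_comm (s := Finset.univ) (t := Finset.univ)
      (f := fun (t : Fin (m+1) → F) (p : Matrix (Fin (m+1)) (Fin n) F) =>
        g (p * Y + Matrix.vecMulVec t ((P * Y) i)) * G (Y * p * X))] at e1
    simp only [← Finset.sum_mul, sum_line g hg _ hi, zero_mul, Finset.sum_const_zero] at e1
    rw [Finset.sum_const, nsmul_eq_mul] at e1
    rcases mul_eq_zero.mp e1 with h | h
    · exact absurd h (by rw [Finset.card_univ]; exact_mod_cast Fintype.card_ne_zero)
    · exact h
  have hsum : ∑ Y : Matrix (Fin n) (Fin (m+1)) F, ∑ p : Matrix (Fin (m+1)) (Fin n) F,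
        g (p * Y) * G (Y * p * X)
      = ∑ A : Matrix (Fin (m+1)) (Fin (m+1)) F, ∑ p : Matrix (Fin (m+1)) (Fin n) F,
        g (p * (X * A)) * G (X * A * p * X) := by
    symm
    have hinj : Function.Injective (fun A : Matrix (Fin (m+1)) (Fin (m+1)) F => X * A) := by
      intro A B hAB
      have := congrArg (fun M => p0 * M) hAB
      simpa only [← Matrix.mul_assoc, hp0, Matrix.one_mul] using this
    rw [← Finset.sum_image (s := Finset.univ) (g := fun A : Matrix (Fin (m+1)) (Fin (m+1)) F => X * A)
      (f := fun Y => ∑ p : Matrix (Fin (m+1)) (Fin n) F, g (p * Y) * G (Y * p * X))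
      (fun a _ b _ h => hinj h)]
    apply Finset.sum_subset (Finset.subset_univ _)
    intro Y _ hY
    apply hvan
    intro h
    exact hY (Finset.mem_image.mpr ⟨p0 * Y, Finset.mem_univ _, h.symm⟩)
  rw [hsum, mul_assoc, hc3, Finset.sum_mul, Finset.mul_sum]
  refine Finset.sum_congr rfl fun A _ => ?_
  have := havg (fun h => g (h * A) * G (X * A * h))
  simp only [← Matrix.mul_assoc] at this ⊢
  rw [this, Finset.sum_mul]
  congr 1
  refine Finset.sum_congr rfl fun h _ => ?_
  by_cases hA : h * A = 1
  · have hA' : A * h = 1 := mul_eq_one_comm.mp hA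
    rw [hA, hg1, Matrix.mul_assoc, hA', if_pos rfl, Matrix.mul_one]
  · rw [if_neg hA, zero_mul]
    by_cases hf : Fac m (h * A)
    · have : Fac m (A * h) := by
        rcases fac_or_inv (A * h) with h' | ⟨p, hp⟩
        · exact h'
        · exfalso
          have hu : (A * h).det ≠ 0 := by
            intro h0
            have := congrArg Matrix.det hp
            rw [Matrix.det_mul, h0] at this
            simp at this
          have hu' : IsUnit (h * A).det := by
            rw [Matrix.det_mul, mul_comm, ← Matrix.det_mul]
            exact isUnit_iff_ne_zero.mpr hu
          exact not_fac_of_inv _ _ (Matrix.nonsing_inv_mul _ hu') hf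
      rw [Matrix.mul_assoc, hG _ (this.mul_left _), mul_zero]
    · rw [hg2 _ hf hA, zero_mul]

lemma exists_eps [Fintype F] (k : Type*) [Field k] [CharZero k] (m : ℕ) : ∀ n : ℕ,
    ∃ c : Matrix (Fin n) (Fin n) F → k, (∀ Z, c Z ≠ 0 → Fac m Z) ∧
      ∀ (l : ℕ) (X : Matrix (Fin n) (Fin l) F), Fac m X →
        ∀ f : Matrix (Fin n) (Fin l) F → k, ∑ Z, c Z * f (Z * X) = f X := by
  classical
  induction m with
  | zero =>
    intro n
    refine ⟨fun Z => if Z = 0 then 1 else 0, ?_, ?_⟩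
    · intro Z hZ
      have : Z = 0 := by by_contra h; simp [h] at hZ
      exact ⟨0, 0, by rw [this]; simp⟩
    · rintro l X ⟨A, B, rfl⟩ f
      have : A * B = 0 := by ext; simp [Matrix.mul_apply]
      simp [this]
  | succ m ih =>
    intro n
    obtain ⟨cn, hn1, hn2⟩ := ih n
    obtain ⟨cs, hs1, hs2⟩ := ih (m+1)
    have h1f : ¬ Fac m (1 : Matrix (Fin (m+1)) (Fin (m+1)) F) :=
      not_fac_of_inv 1 1 (Matrix.one_mul 1)
    obtain ⟨K, hK, hkey⟩ := key (F := F) (k := k) (m := m) n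
      (fun e => (if e = 1 then 1 else 0) - cs e)
      (by
        intro N hN f
        simp only [sub_mul, Finset.sum_sub_distrib, hs2 _ N hN f]
        simp)
      (by
        have : cs 1 = 0 := by by_contra h; exact h1f (hs1 _ h)
        simp [this])
      (by
        intro e he h1
        have : cs e = 0 := by by_contra h; exact he (hs1 _ h)
        simp [this, h1])
    set g : Matrix (Fin (m+1)) (Fin (m+1)) F → k :=
      fun e => (if e = 1 then 1 else 0) - cs e with hgdef
    -- the family
    let w : Matrix (Fin n) (Fin n) F ⊕ ((Matrix (Fin n) (Fin (m+1)) F × Matrix (Fin (m+1)) (Fin n) F) ⊕ Matrix (Fin n) (Fin n) F × (Matrix (Fin n) (Fin (m+1)) F × Matrix (Fin (m+1)) (Fin n) F)) → k := Sum.elim cn (Sum.elim (fun i => K⁻¹ * g (i.2 * i.1))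
      (fun x => - (cn x.1 * (K⁻¹ * g (x.2.2 * x.2.1)))))
    let z : Matrix (Fin n) (Fin n) F ⊕ ((Matrix (Fin n) (Fin (m+1)) F × Matrix (Fin (m+1)) (Fin n) F) ⊕ Matrix (Fin n) (Fin n) F × (Matrix (Fin n) (Fin (m+1)) F × Matrix (Fin (m+1)) (Fin n) F)) → Matrix (Fin n) (Fin n) F := Sum.elim id (Sum.elim (fun i => i.1 * i.2)
      (fun x => x.1 * (x.2.1 * x.2.2)))
    refine ⟨fun Z => ∑ x, if z x = Z then w x else 0, ?_, ?_⟩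
    · intro Z hZ
      obtain ⟨x, _, hx⟩ := Finset.exists_ne_zero_of_sum_ne_zero hZ
      have hzx : z x = Z := by by_contra h; simp [h] at hx
      rw [if_pos hzx] at hx
      rw [← hzx]
      rcases x with x | x | x
      · exact (hn1 x hx).succ
      · exact ⟨x.1, x.2, rfl⟩
      · exact Fac.mul_left ⟨x.2.1, x.2.2, rfl⟩ _
    · rintro l _ ⟨X, Q, rfl⟩ f
      have e0 : ∑ Z, (∑ x, if z x = Z then w x else 0) * f (Z * (X * Q))
          = ∑ x, w x * f (z x * (X * Q)) := by
        simp only [Finset.sum_mul]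
        rw [Finset.sum_comm]
        refine Finset.sum_congr rfl fun x _ => ?_
        simp only [ite_mul, zero_mul, Finset.sum_ite_eq, Finset.mem_univ, if_true]
      rw [e0]
      let G : Matrix (Fin n) (Fin (m+1)) F → k :=
        fun Y => f (Y * Q) - ∑ Z, cn Z * f (Z * (Y * Q))
      have hG : ∀ Y, Fac m Y → G Y = 0 := by
        intro Y hY
        simp only [G]
        rw [hn2 l (Y * Q) (hY.mul_right Q) f, sub_self]
      have hk := hkey G hG X
      have e1 : G X = ∑ i : (Matrix (Fin n) (Fin (m+1)) F × Matrix (Fin (m+1)) (Fin n) F), K⁻¹ * g (i.2 * i.1) * G (i.1 * i.2 * X) := by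
        simp only [mul_assoc, ← Finset.mul_sum]
        rw [Fintype.sum_prod_type, eq_inv_mul_iff_mul_eq₀ hK, ← hk]
      have e2 : f (X * Q) = ∑ Z, cn Z * f (Z * (X * Q)) + G X := by simp [G]
      rw [e2, e1, Fintype.sum_sum_type, Fintype.sum_sum_type]
      congr 1
      rw [Fintype.sum_prod_type (f := fun x : Matrix (Fin n) (Fin n) F × (Matrix (Fin n) (Fin (m+1)) F × Matrix (Fin (m+1)) (Fin n) F) => w (Sum.inr (Sum.inr x)) *
        f (z (Sum.inr (Sum.inr x)) * (X * Q))), Finset.sum_comm, ← Finset.sum_add_distrib]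
      refine Finset.sum_congr rfl fun i _ => ?_
      simp only [w, z, G, Sum.elim_inr, Sum.elim_inl, Matrix.mul_assoc]
      generalize g (i.2 * i.1) = u
      rw [mul_sub, sub_eq_add_neg, Finset.mul_sum, ← Finset.sum_neg_distrib]
      congr 1
      refine Finset.sum_congr rfl fun Z _ => ?_
      ring

end aux

/-- Schur–Weyl duality for matrix monoids: for a finite field `F` and a field
`k` of characteristic `0`, the image of `k[M_n]` in `End_k(k[M_{n,m}])` (the
span of the left-multiplication operators) is exactly the centralizer of the
image of `k[M_m]` (the span of the right-multiplication operators), and vice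
versa. -/
theorem matrix_monoid_schur_weyl (F : Type*) [Field F] [Fintype F] (n m : ℕ)
    (k : Type*) [Field k] [CharZero k] :
    (∀ φ : Module.End k (Matrix (Fin n) (Fin m) F →₀ k),
      φ ∈ Submodule.span k (Set.range (Lop F n m k)) ↔
        ∀ b : Matrix (Fin m) (Fin m) F, φ * Rop F n m k b = Rop F n m k b * φ) ∧
    (∀ φ : Module.End k (Matrix (Fin n) (Fin m) F →₀ k),
      φ ∈ Submodule.span k (Set.range (Rop F n m k)) ↔
        ∀ a : Matrix (Fin n) (Fin n) F, φ * Lop F n m k a = Lop F n m k a * φ) := by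
  classical
  have hL : ∀ a X, Lop F n m k a (Finsupp.single X 1) = Finsupp.single (a * X) 1 := by
    intro a X; simp [Lop, Finsupp.mapDomain_single]
  have hR : ∀ b X, Rop F n m k b (Finsupp.single X 1) = Finsupp.single (X * b) 1 := by
    intro a X; simp [Rop, Finsupp.mapDomain_single]
  have hext : ∀ φ ψ : Module.End k (Matrix (Fin n) (Fin m) F →₀ k),
      (∀ X, φ (Finsupp.single X 1) = ψ (Finsupp.single X 1)) → φ = ψ := by
    intro φ ψ h
    refine Finsupp.lhom_ext' fun X => LinearMap.ext_ring (h X)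
  have hcomm : ∀ a b, Lop F n m k a * Rop F n m k b = Rop F n m k b * Lop F n m k a := by
    intro a b
    apply hext
    intro X
    simp only [Module.End.mul_apply, hL, hR, Matrix.mul_assoc]
  have hexp : ∀ v : Matrix (Fin n) (Fin m) F →₀ k, v = ∑ W, v W • Finsupp.single W (1 : k) := by
    intro v
    ext W
    simp [Finsupp.finsetSum_apply, Finsupp.single_apply]
  refine ⟨fun φ => ⟨fun h b => ?_, fun h => ?_⟩, fun φ => ⟨fun h a => ?_, fun h => ?_⟩⟩
  · induction h using Submodule.span_induction with
    | mem x hx => obtain ⟨a, rfl⟩ := hx; exact hcomm a b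
    | zero => simp
    | add x y _ _ hx hy => rw [add_mul, mul_add, hx, hy]
    | smul c x _ hx => rw [smul_mul_assoc, mul_smul_comm, hx]
  · obtain ⟨c, hc1, hc2⟩ := exists_eps (F := F) k m n
    have hch : ∀ Z, ∃ (A : Matrix (Fin n) (Fin m) F) (B : Matrix (Fin m) (Fin n) F),
        c Z ≠ 0 → Z = A * B := by
      intro Z
      by_cases hz : c Z = 0
      · exact ⟨0, 0, fun h => absurd hz h⟩
      · obtain ⟨A, B, hAB⟩ := hc1 Z hz
        exact ⟨A, B, fun _ => hAB⟩
    choose A B hAB using hch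
    have hφ : φ = ∑ Z, ∑ W, (c Z * φ (Finsupp.single (A Z) 1) W) • Lop F n m k (W * B Z) := by
      apply hext
      intro X
      have h1 : φ (Finsupp.single X 1) = ∑ Z, c Z • φ (Finsupp.single (Z * X) 1) := by
        ext V
        have := hc2 m X ⟨X, 1, by simp⟩ (fun Y => φ (Finsupp.single Y 1) V)
        rw [← this]
        simp [Finsupp.finsetSum_apply]
      rw [h1, LinearMap.sum_apply]
      refine Finset.sum_congr rfl fun Z _ => ?_
      by_cases hz : c Z = 0
      · simp [hz]
      have h2 : φ (Finsupp.single (Z * X) 1) =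
          Rop F n m k (B Z * X) (φ (Finsupp.single (A Z) 1)) := by
        have := LinearMap.congr_fun (h (B Z * X)) (Finsupp.single (A Z) 1)
        simp only [Module.End.mul_apply, hR] at this
        rw [← this, ← Matrix.mul_assoc, ← hAB Z hz]
      rw [h2, hexp (φ (Finsupp.single (A Z) 1)), map_sum, Finset.smul_sum, LinearMap.sum_apply,
        ← hexp (φ (Finsupp.single (A Z) 1))]
      refine Finset.sum_congr rfl fun W _ => ?_
      rw [LinearMap.smul_apply, hL, map_smul, hR, smul_smul, Matrix.mul_assoc]
    rw [hφ]
    exact Submodule.sum_mem _ fun Z _ => Submodule.sum_mem _ fun W _ =>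
      Submodule.smul_mem _ _ (Submodule.subset_span ⟨_, rfl⟩)
  · induction h using Submodule.span_induction with
    | mem x hx => obtain ⟨b, rfl⟩ := hx; exact (hcomm a b).symm
    | zero => simp
    | add x y _ _ hx hy => rw [add_mul, mul_add, hx, hy]
    | smul c x _ hx => rw [smul_mul_assoc, mul_smul_comm, hx]
  · obtain ⟨c, hc1, hc2⟩ := exists_eps (F := F) k n m
    have hch : ∀ Z, ∃ (A : Matrix (Fin m) (Fin n) F) (B : Matrix (Fin n) (Fin m) F),
        c Z ≠ 0 → Z = A * B := by
      intro Z
      by_cases hz : c Z = 0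
      · exact ⟨0, 0, fun h => absurd hz h⟩
      · obtain ⟨A, B, hAB⟩ := hc1 Z hz
        exact ⟨A, B, fun _ => hAB⟩
    choose A B hAB using hch
    have hφ : φ = ∑ Z, ∑ W, (c Z * φ (Finsupp.single (A Z).transpose 1) W) •
        Rop F n m k ((B Z).transpose * W) := by
      apply hext
      intro X
      have h1 : φ (Finsupp.single X 1) = ∑ Z, c Z • φ (Finsupp.single (X * Z.transpose) 1) := by
        ext V
        have := hc2 n X.transpose ⟨X.transpose, 1, by simp⟩
          (fun Y => φ (Finsupp.single Y.transpose 1) V)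
        simp only [Matrix.transpose_mul, Matrix.transpose_transpose] at this
        rw [← this]
        simp [Finsupp.finsetSum_apply]
      rw [h1, LinearMap.sum_apply]
      refine Finset.sum_congr rfl fun Z _ => ?_
      by_cases hz : c Z = 0
      · simp [hz]
      have h2 : φ (Finsupp.single (X * Z.transpose) 1) =
          Lop F n m k (X * (B Z).transpose) (φ (Finsupp.single (A Z).transpose 1)) := by
        have := LinearMap.congr_fun (h (X * (B Z).transpose)) (Finsupp.single (A Z).transpose 1)
        simp only [Module.End.mul_apply, hL] at this
        rw [← this, Matrix.mul_assoc, ← Matrix.transpose_mul, ← hAB Z hz]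
      rw [h2, hexp (φ (Finsupp.single (A Z).transpose 1)), map_sum, Finset.smul_sum,
        LinearMap.sum_apply, ← hexp (φ (Finsupp.single (A Z).transpose 1))]
      refine Finset.sum_congr rfl fun W _ => ?_
      rw [LinearMap.smul_apply, hR, map_smul, hL, smul_smul, Matrix.mul_assoc]
    rw [hφ]
    exact Submodule.sum_mem _ fun Z _ => Submodule.sum_mem _ fun W _ =>
      Submodule.smul_mem _ _ (Submodule.subset_span ⟨_, rfl⟩)
end

section
/- Let F be a finite field with q elements, n ≥ 1, and r the rank of an n×n matrix T over F with T semi-idempotent of rank ≤ r−1 acting on F^n (identify V_{n-1} = span of first n−1 basis vectors). More precisely: let T : V_{n-1} → V_{n-1} be semi-idempotent. Then the number of semi-idempotent extensions S : V_n → V_n of T with rank S = rank T equals q^{rank T}; the number with rank S = rank T + 1 and srk S = srk T equals q^{n-1} − q^{rank T}; and the number with rank S = rank T + 1 and srk S = srk T + 1 equals q^{n−1−srk T}. -/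
open Polynomial

section

variable {F V : Type*} [Field F] [AddCommGroup V] [Module F V]

/-- The rank of an endomorphism: the dimension of its image. -/
noncomputable def rk (S : Module.End F V) : ℕ := Module.finrank F ↥(LinearMap.range S)

/-- The stable rank of a semi-idempotent endomorphism: the dimension of its
`1`-eigenspace. -/
noncomputable def srk (S : Module.End F V) : ℕ := Module.finrank F ↥(LinearMap.ker (S - 1))

end

/-- The coordinate hyperplane `V_{n} = span(b_1,…,b_n)` inside `F^{n+1}`,
i.e. the kernel of the last coordinate. -/
def lastHyperplane (F : Type*) [Field F] (n : ℕ) : Submodule F (Fin (n + 1) → F) :=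
  LinearMap.ker (LinearMap.proj (R := F) (φ := fun _ : Fin (n + 1) => F) (Fin.last n))

section helpers

theorem semi_iff {F V : Type*} [Field F] [AddCommGroup V] [Module F V]
    (S : Module.End F V) :
    IsSemiIdempotent S ↔ ∃ l : ℕ, ∀ x, (S ^ l) (S x - x) = 0 := by
  unfold IsSemiIdempotent
  refine exists_congr fun l => ?_
  rw [minpoly.dvd_iff]
  simp only [map_mul, map_pow, aeval_X, map_sub, map_one]
  constructor
  · intro h x
    have := LinearMap.congr_fun h x
    simpa using this
  · intro h
    ext1 x
    simpa using h x

variable {F : Type*} [Field F] {n : ℕ}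

/-- last basis vector -/
noncomputable def lb (F : Type*) [Field F] (n : ℕ) : Fin (n + 1) → F := Pi.single (Fin.last n) 1

theorem lb_last : lb F n (Fin.last n) = 1 := by simp [lb]

theorem mem_lh (x : Fin (n + 1) → F) : x ∈ lastHyperplane F n ↔ x (Fin.last n) = 0 := by
  simp [lastHyperplane]

theorem decomp (x : Fin (n + 1) → F) : ∃ w : lastHyperplane F n,
    x = w + x (Fin.last n) • lb F n := by
  refine ⟨⟨x - x (Fin.last n) • lb F n, ?_⟩, ?_⟩
  · rw [mem_lh]; simp [lb_last]
  · simp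

/-- extension predicate -/
def IsExtOf (T : Module.End F (lastHyperplane F n)) (S : Module.End F (Fin (n + 1) → F)) : Prop :=
  ∀ w : ↥(lastHyperplane F n), S w = (T w : Fin (n + 1) → F)

theorem exists_ext (T : Module.End F (lastHyperplane F n)) (u : Fin (n + 1) → F) :
    ∃ S, IsExtOf T S ∧ S (lb F n) = u := by
  let p : (Fin (n + 1) → F) →ₗ[F] F := LinearMap.proj (Fin.last n)
  let pr : (Fin (n + 1) → F) →ₗ[F] lastHyperplane F n :=
    LinearMap.codRestrict _ (LinearMap.id - p.smulRight (lb F n)) (by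
      intro x; rw [mem_lh]; simp [p, lb_last])
  refine ⟨(lastHyperplane F n).subtype ∘ₗ T ∘ₗ pr + p.smulRight u, ?_, ?_⟩
  · intro w
    have h0 : p (w : Fin (n + 1) → F) = 0 := (mem_lh _).1 w.2
    have h1 : pr w = w := by
      apply Subtype.ext
      simp [pr, h0]
    simp [h0, h1]
  · have h0 : p (lb F n) = 1 := lb_last
    have h1 : pr (lb F n) = 0 := by
      apply Subtype.ext
      simp [pr, h0]
    simp [h0, h1]

theorem ext_unique {T : Module.End F (lastHyperplane F n)} {S S' : Module.End F (Fin (n + 1) → F)}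
    (h : IsExtOf T S) (h' : IsExtOf T S') (e : S (lb F n) = S' (lb F n)) : S = S' := by
  apply LinearMap.ext
  intro x
  obtain ⟨w, hw⟩ := decomp x
  rw [hw]
  simp [h w, h' w, e]

theorem IsExtOf.pow {T : Module.End F (lastHyperplane F n)} {S : Module.End F (Fin (n + 1) → F)}
    (h : IsExtOf T S) (l : ℕ) : IsExtOf (T ^ l) (S ^ l) := by
  induction l with
  | zero => intro w; simp
  | succ k ih => intro w; rw [pow_succ, pow_succ]; simp [h w, ih (T w)]

theorem IsExtOf.sub_one {T : Module.End F (lastHyperplane F n)} {S : Module.End F (Fin (n + 1) → F)}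
    (h : IsExtOf T S) : IsExtOf (T - 1) (S - 1) := by
  intro w; simp [h w]

theorem IsExtOf.last {T : Module.End F (lastHyperplane F n)} {S : Module.End F (Fin (n + 1) → F)}
    (h : IsExtOf T S) (x : Fin (n + 1) → F) :
    S x (Fin.last n) = x (Fin.last n) * S (lb F n) (Fin.last n) := by
  obtain ⟨w, hw⟩ := decomp x
  conv_lhs => rw [hw]
  have := (mem_lh _).1 (T w).2
  simp [h w, this]

theorem IsExtOf.range {T : Module.End F (lastHyperplane F n)} {S : Module.End F (Fin (n + 1) → F)}
    (h : IsExtOf T S) : LinearMap.range S =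
      (LinearMap.range T).map (lastHyperplane F n).subtype ⊔ Submodule.span F {S (lb F n)} := by
  apply le_antisymm
  · rintro _ ⟨x, rfl⟩
    obtain ⟨w, hw⟩ := decomp x
    rw [hw, map_add, map_smul, h w]
    apply Submodule.add_mem_sup
    · exact ⟨T w, ⟨w, rfl⟩, rfl⟩
    · exact Submodule.smul_mem _ _ (Submodule.mem_span_singleton_self _)
  · apply sup_le
    · rintro _ ⟨_, ⟨w, rfl⟩, rfl⟩
      exact ⟨w, h w⟩
    · rw [Submodule.span_singleton_le_iff_mem]
      exact ⟨_, rfl⟩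

/-- image of the range inside the big space -/
abbrev R (T : Module.End F (lastHyperplane F n)) : Submodule F (Fin (n + 1) → F) :=
  (LinearMap.range T).map (lastHyperplane F n).subtype

theorem finrank_R (T : Module.End F (lastHyperplane F n)) : Module.finrank F (R T) = rk T :=
  Submodule.finrank_map_subtype_eq _ _

theorem R_last {T : Module.End F (lastHyperplane F n)} {u : Fin (n + 1) → F} (h : u ∈ R T) :
    u (Fin.last n) = 0 := by
  obtain ⟨w, _, rfl⟩ := h
  exact (mem_lh _).1 w.2

theorem IsExtOf.rk_of_mem {T : Module.End F (lastHyperplane F n)} {S : Module.End F (Fin (n + 1) → F)}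
    (h : IsExtOf T S) (hu : S (lb F n) ∈ R T) : rk S = rk T := by
  rw [← finrank_R, rk, h.range, sup_eq_left.2]
  rwa [Submodule.span_singleton_le_iff_mem]

theorem IsExtOf.rk_of_not_mem {T : Module.End F (lastHyperplane F n)}
    {S : Module.End F (Fin (n + 1) → F)}
    (h : IsExtOf T S) (hu : S (lb F n) ∉ R T) : rk S = rk T + 1 := by
  have h0 : S (lb F n) ≠ 0 := by rintro h; rw [h] at hu; exact hu (zero_mem _)
  have h1 := Submodule.finrank_sup_add_finrank_inf_eq (R T) (Submodule.span F {S (lb F n)})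
  rw [(Submodule.disjoint_span_singleton' h0 |>.2 hu).eq_bot, finrank_bot,
    finrank_span_singleton h0, finrank_R] at h1
  rw [rk, h.range]
  exact h1

theorem finrank_lh : Module.finrank F (lastHyperplane F n) = n := by
  have h := LinearMap.finrank_range_add_finrank_ker
    (LinearMap.proj (R := F) (φ := fun _ : Fin (n + 1) => F) (Fin.last n))
  rw [LinearMap.range_eq_top.2 (LinearMap.proj_surjective _)] at h
  simp only [finrank_top, Module.finrank_self, Module.finrank_fin_fun] at h
  unfold lastHyperplane
  omega

theorem rk_sub_one (T : Module.End F (lastHyperplane F n)) : rk (T - 1) + srk T = n := by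
  have h := LinearMap.finrank_range_add_finrank_ker (T - 1)
  rwa [finrank_lh] at h

theorem IsExtOf.srk_zero {T : Module.End F (lastHyperplane F n)}
    {S : Module.End F (Fin (n + 1) → F)}
    (h : IsExtOf T S) (hu : S (lb F n) (Fin.last n) = 0) : srk S = srk T := by
  have : LinearMap.ker (S - 1) = (LinearMap.ker (T - 1)).map (lastHyperplane F n).subtype := by
    ext x
    constructor
    · intro hx
      have hx' : S x = x := by simpa [sub_eq_zero] using hx
      have h2 := h.last x
      rw [hu, hx', mul_zero] at h2
      refine ⟨⟨x, (mem_lh x).2 h2⟩, ?_, rfl⟩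
      have h3 := h ⟨x, (mem_lh x).2 h2⟩
      simp only [SetLike.mem_coe, LinearMap.mem_ker, LinearMap.sub_apply, Module.End.one_apply]
      rw [sub_eq_zero]
      apply Subtype.ext
      rw [← h3]
      exact hx'
    · rintro ⟨w, hw, rfl⟩
      have h3 := h.sub_one w
      have hw' : (T - 1) w = 0 := hw
      rw [hw'] at h3
      exact h3
  rw [srk, this, srk]
  exact Submodule.finrank_map_subtype_eq _ _

theorem IsExtOf.srk_one {T : Module.End F (lastHyperplane F n)}
    {S : Module.End F (Fin (n + 1) → F)}
    (h : IsExtOf T S) (hu : S (lb F n) - lb F n ∈ R (T - 1)) : srk S = srk T + 1 := by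
  have h1 := h.sub_one.rk_of_mem (by simpa using hu)
  have h2 := rk_sub_one T
  have h3 := LinearMap.finrank_range_add_finrank_ker (S - 1)
  rw [Module.finrank_fin_fun] at h3
  change rk (S - 1) + srk S = n + 1 at h3
  omega

theorem IsExtOf.semi_iff {T : Module.End F (lastHyperplane F n)}
    {S : Module.End F (Fin (n + 1) → F)} (hT : IsSemiIdempotent T)
    (h : IsExtOf T S) : IsSemiIdempotent S ↔
      S (lb F n) (Fin.last n) = 0 ∨ S (lb F n) - lb F n ∈ R (T - 1) := by
  rw [_root_.semi_iff] at hT ⊢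
  obtain ⟨l, hl⟩ := hT
  have hW : ∀ w : lastHyperplane F n, (S ^ l) (S w - w) = 0 := by
    intro w
    have h1 := h.pow l (T w - w)
    rw [hl w] at h1
    rw [h w]
    simpa using h1
  constructor
  · rintro ⟨k, hk⟩
    have hp : ∀ (j : ℕ) (x : Fin (n + 1) → F), (S ^ j) x (Fin.last n) =
        x (Fin.last n) * (S (lb F n) (Fin.last n)) ^ j := by
      intro j
      induction j with
      | zero => simp
      | succ j ih =>
        intro x
        rw [pow_succ, Module.End.mul_apply, ih, h.last x]; ring
    have h1 := hp k (S (lb F n) - lb F n)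
    rw [hk] at h1
    simp only [Pi.zero_apply, Pi.sub_apply, lb_last] at h1
    rcases mul_eq_zero.1 h1.symm with h2 | h2
    · right
      let v : lastHyperplane F n := ⟨S (lb F n) - lb F n, by rw [mem_lh]; simpa [lb_last] using h2⟩
      have hv : (T ^ k) v = 0 := by
        apply Subtype.ext
        rw [← h.pow k v]
        exact hk _
      refine ⟨v, ⟨-((∑ i ∈ Finset.range k, T ^ i) v), ?_⟩, rfl⟩
      have h4 := LinearMap.congr_fun (mul_geom_sum T k) v
      rw [Module.End.mul_apply, LinearMap.sub_apply (T ^ k), hv] at h4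
      rw [map_neg, h4]
      simp
    · left
      exact eq_zero_of_pow_eq_zero h2
  · rintro (h1 | ⟨_, ⟨w, rfl⟩, hw⟩)
    · refine ⟨l + 1, fun x => ?_⟩
      have h2 : S x ∈ lastHyperplane F n := by rw [mem_lh, h.last, h1, mul_zero]
      have h3 := hW ⟨S x, h2⟩
      rw [pow_succ, Module.End.mul_apply, map_sub]
      exact h3
    · refine ⟨l, fun x => ?_⟩
      obtain ⟨y, hy⟩ := decomp x
      have e : S x - x = (S y - y) + x (Fin.last n) • (S (lb F n) - lb F n) := by
        conv_lhs => rw [hy]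
        rw [map_add, map_smul, smul_sub]; abel
      have e2 : S (lb F n) - lb F n = S w - w := by
        rw [← hw, h w]; simp
      rw [e, e2, map_add, map_smul, hW, hW]; simp

theorem R_one_last {T : Module.End F (lastHyperplane F n)} {u : Fin (n + 1) → F}
    (h : u - lb F n ∈ R T) : u (Fin.last n) = 1 := by
  have := R_last h
  simpa [lb_last, sub_eq_zero] using this

theorem card_transfer (T : Module.End F (lastHyperplane F n))
    (P : Module.End F (Fin (n + 1) → F) → Prop) (Q : (Fin (n + 1) → F) → Prop)
    (hP : ∀ S, P S → IsExtOf T S) (hPQ : ∀ S, IsExtOf T S → (P S ↔ Q (S (lb F n)))) :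
    Nat.card {S // P S} = Nat.card {u // Q u} := by
  refine Nat.card_congr (Equiv.ofBijective
    (fun S => ⟨S.1 (lb F n), (hPQ S.1 (hP _ S.2)).1 S.2⟩) ⟨?_, ?_⟩)
  · intro S S' e
    exact Subtype.ext (ext_unique (hP _ S.2) (hP _ S'.2) (congrArg Subtype.val e))
  · rintro ⟨u, hu⟩
    obtain ⟨S, hS, rfl⟩ := exists_ext T u
    exact ⟨⟨S, (hPQ S hS).2 hu⟩, rfl⟩

end helpers

/-- Counting semi-idempotent extensions: let `F` be a finite field with `q`
elements and `T` a semi-idempotent endomorphism of the hyperplane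
`V_n = span(b_1,…,b_n) ⊆ F^{n+1}`.  Among the semi-idempotent endomorphisms `S`
of `F^{n+1}` extending `T` (`S|_{V_n} = T`):
* the number with `rank S = rank T` is `q^{rank T}`;
* the number with `rank S = rank T + 1` and `srk S = srk T` is `q^n - q^{rank T}`;
* the number with `rank S = rank T + 1` and `srk S = srk T + 1` is `q^{n - srk T}`. -/
theorem count_extensions (F : Type*) [Field F] [Fintype F] (n : ℕ)
    (T : Module.End F ↥(lastHyperplane F n))
    (hT : IsSemiIdempotent T) :
    Nat.card {S : Module.End F (Fin (n + 1) → F) // IsSemiIdempotent S ∧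
        (∀ w : ↥(lastHyperplane F n), S w = (T w : Fin (n + 1) → F)) ∧
        rk S = rk T}
      = Fintype.card F ^ rk T ∧
    Nat.card {S : Module.End F (Fin (n + 1) → F) // IsSemiIdempotent S ∧
        (∀ w : ↥(lastHyperplane F n), S w = (T w : Fin (n + 1) → F)) ∧
        rk S = rk T + 1 ∧ srk S = srk T}
      = Fintype.card F ^ n - Fintype.card F ^ rk T ∧
    Nat.card {S : Module.End F (Fin (n + 1) → F) // IsSemiIdempotent S ∧
        (∀ w : ↥(lastHyperplane F n), S w = (T w : Fin (n + 1) → F)) ∧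
        rk S = rk T + 1 ∧ srk S = srk T + 1}
      = Fintype.card F ^ (n - srk T) := by
  classical
  have hcard : ∀ U : Submodule F (Fin (n + 1) → F),
      Nat.card U = Fintype.card F ^ Module.finrank F U := by
    intro U
    rw [Module.natCard_eq_pow_finrank (K := F), Nat.card_eq_fintype_card]
  refine ⟨?_, ?_, ?_⟩
  · rw [card_transfer T _ (fun u => u ∈ R T) (fun S h => h.2.1), ← finrank_R, ← hcard]
    intro S hS
    constructor
    · rintro ⟨_, _, h⟩
      by_contra hc
      have := hS.rk_of_not_mem hc
      omega
    · intro h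
      exact ⟨(hS.semi_iff hT).2 (Or.inl (R_last h)), hS, hS.rk_of_mem h⟩
  · rw [card_transfer T _ (fun u => u ∈ (lastHyperplane F n : Set (Fin (n + 1) → F)) \ (R T))
      (fun S h => h.2.1)]
    · have hle : (R T : Set (Fin (n + 1) → F)) ⊆ lastHyperplane F n := by
        intro u hu
        exact (mem_lh u).2 (R_last hu)
      have h1 := Set.ncard_sdiff hle (Set.toFinite _)
      have h2 := hcard (lastHyperplane F n)
      have h3 := hcard (R T)
      rw [finrank_lh] at h2
      rw [finrank_R] at h3
      rw [← h2, ← h3]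
      exact h1
    · intro S hS
      rw [Set.mem_sdiff, SetLike.mem_coe, SetLike.mem_coe, mem_lh]
      constructor
      · rintro ⟨hs, _, hr, hsr⟩
        constructor
        · rcases (hS.semi_iff hT).1 hs with h | h
          · exact h
          · have := hS.srk_one h
            omega
        · intro hc
          have := hS.rk_of_mem hc
          omega
      · rintro ⟨h1, h2⟩
        exact ⟨(hS.semi_iff hT).2 (Or.inl h1), hS, hS.rk_of_not_mem h2, hS.srk_zero h1⟩
  · rw [card_transfer T _ (fun u => u - lb F n ∈ R (T - 1)) (fun S h => h.2.1)]
    · have h1 : n - srk T = rk (T - 1) := by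
        have := rk_sub_one T
        omega
      rw [h1, ← finrank_R, ← hcard]
      exact Nat.card_congr ((Equiv.subRight (lb F n)).subtypeEquiv fun u => Iff.rfl)
    · intro S hS
      constructor
      · rintro ⟨hs, _, hr, hsr⟩
        rcases (hS.semi_iff hT).1 hs with h | h
        · have := hS.srk_zero h
          omega
        · exact h
      · intro h
        refine ⟨(hS.semi_iff hT).2 (Or.inr h), hS, hS.rk_of_not_mem ?_, hS.srk_one h⟩
        intro hc
        have h1 := R_last hc
        rw [R_one_last h] at h1
        exact one_ne_zero h1
end
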